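/- Let g be holomorphic on 𝔻 with g ∈ 𝓑 \ 𝓑_{log,0}. Then there exists a function F ∈ 𝓑 such that T_g F ∈ 𝓑 \ 𝓑₀. -/

import Mathlib

open Complex MeasureTheory Set Filter

noncomputable section

/-- The open unit disc in the complex plane. -/
def unitDisc : Set ℂ := Metric.ball 0 1

/-- The Möbius involution `φ_a(z) = (a - z)/(1 - conj(a) z)`. -/
def mobius (a z : ℂ) : ℂ := (a - z) / (1 - (starRingEnd ℂ) a * z)

/-- The hyperbolic distance on the unit disc. -/
def hypDist (a z : ℂ) : ℝ :=
  (1 / 2) * Real.log ((1 + ‖mobius a z‖) / (1 - ‖mobius a z‖))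

/-- The `BMOA` Garsia-type seminorm squared at the point `a`, with normalized
area measure `dm = dx dy / π`. -/
def bmoaSemi (f : ℂ → ℂ) (a : ℂ) : ℝ :=
  (Real.pi)⁻¹ * ∫ z in unitDisc, ‖deriv f z‖ ^ 2 * (1 - ‖mobius a z‖ ^ 2)

/-- `f` is an analytic function of bounded mean oscillation. -/
def IsBMOA (f : ℂ → ℂ) : Prop :=
  DifferentiableOn ℂ f unitDisc ∧ ∃ C : ℝ, ∀ a ∈ unitDisc, bmoaSemi f a ≤ C

/-- `f` is an analytic function of vanishing mean oscillation. -/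
def IsVMOA (f : ℂ → ℂ) : Prop :=
  IsBMOA f ∧ ∀ ε > 0, ∃ r < 1, ∀ a ∈ unitDisc, r < ‖a‖ → bmoaSemi f a < ε

/-- The Bloch quantity `|f'(z)| (1 - |z|²)`. -/
def blochSemi (f : ℂ → ℂ) (z : ℂ) : ℝ := ‖deriv f z‖ * (1 - ‖z‖ ^ 2)

/-- `f` belongs to the Bloch space. -/
def IsBloch (f : ℂ → ℂ) : Prop :=
  DifferentiableOn ℂ f unitDisc ∧ ∃ C : ℝ, ∀ z ∈ unitDisc, blochSemi f z ≤ C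

/-- `f` belongs to the little Bloch space. -/
def IsLittleBloch (f : ℂ → ℂ) : Prop :=
  IsBloch f ∧ ∀ ε > 0, ∃ r < 1, ∀ z ∈ unitDisc, r < ‖z‖ → blochSemi f z < ε

/-- The `BMOA` norm `|f(0)| + ‖f‖_*`. -/
def bmoaNorm (f : ℂ → ℂ) : ℝ :=
  ‖f 0‖ + Real.sqrt (⨆ a : unitDisc, bmoaSemi f (a : ℂ))

/-- The Bloch norm `|f(0)| + sup_z |f'(z)|(1-|z|²)`. -/
def blochNorm (f : ℂ → ℂ) : ℝ :=
  ‖f 0‖ + ⨆ z : unitDisc, blochSemi f (z : ℂ)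

/-- `φ` is a semigroup of holomorphic self-maps of the unit disc. -/
def IsHoloSemigroup (φ : ℝ → ℂ → ℂ) : Prop :=
  (∀ t : ℝ, 0 ≤ t → DifferentiableOn ℂ (φ t) unitDisc ∧ MapsTo (φ t) unitDisc unitDisc) ∧
  (∀ z ∈ unitDisc, φ 0 z = z) ∧
  (∀ t : ℝ, 0 ≤ t → ∀ s : ℝ, 0 ≤ s → ∀ z ∈ unitDisc, φ (t + s) z = φ t (φ s z)) ∧
  (∀ K ⊆ unitDisc, IsCompact K →
    TendstoUniformlyOn (fun t z => φ t z) id (nhdsWithin 0 (Ioi 0)) K)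

/-- The maximal subspace of strong continuity `[φ_t, BMOA]`. -/
def maxSubspaceBMOA (φ : ℝ → ℂ → ℂ) : Set (ℂ → ℂ) :=
  {f | IsBMOA f ∧
    Tendsto (fun t => bmoaNorm (fun z => f (φ t z) - f z)) (nhdsWithin 0 (Ioi 0)) (nhds 0)}

/-- The maximal subspace of strong continuity `[φ_t, 𝓑]`. -/
def maxSubspaceBloch (φ : ℝ → ℂ → ℂ) : Set (ℂ → ℂ) :=
  {f | IsBloch f ∧
    Tendsto (fun t => blochNorm (fun z => f (φ t z) - f z)) (nhdsWithin 0 (Ioi 0)) (nhds 0)}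

/-- `G` is the infinitesimal generator of the semigroup `φ`. -/
def IsGenerator (φ : ℝ → ℂ → ℂ) (G : ℂ → ℂ) : Prop :=
  DifferentiableOn ℂ G unitDisc ∧
  ∀ z ∈ unitDisc,
    Tendsto (fun t : ℝ => (φ t z - z) / (t : ℂ)) (nhdsWithin 0 (Ioi 0)) (nhds (G z))

/-- The semigroup is elliptic: its Denjoy–Wolff point lies in the disc. -/
def IsElliptic (φ : ℝ → ℂ → ℂ) : Prop :=
  ∃ τ ∈ unitDisc, ∀ t : ℝ, 0 ≤ t → φ t τ = τ

/-- The logarithmic vanishing Bloch condition (LVB) on a generator `G`. -/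
def LVB (G : ℂ → ℂ) : Prop :=
  ∀ ε > 0, ∃ r < 1, ∀ z ∈ unitDisc, r < ‖z‖ →
    (1 - ‖z‖ ^ 2) / ‖G z‖ * Real.log (1 / (1 - ‖z‖ ^ 2)) < ε

/-- The logarithmic vanishing mean oscillation condition (LVMO) on a generator `G`. -/
def LVMO (G : ℂ → ℂ) : Prop :=
  ∀ ε > 0, ∃ r < 1, ∀ a ∈ unitDisc, r < ‖a‖ →
    (Real.log (Real.exp 1 / (1 - ‖a‖ ^ 2))) ^ 2 *
      ((Real.pi)⁻¹ * ∫ z in unitDisc, (1 - ‖mobius a z‖ ^ 2) / ‖G z‖ ^ 2) < ε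

/-- `f` belongs to the logarithmic little Bloch space `𝓑_{log,0}`. -/
def InBlochLog0 (f : ℂ → ℂ) : Prop :=
  ∀ ε > 0, ∃ r < 1, ∀ z ∈ unitDisc, r < ‖z‖ →
    ‖deriv f z‖ * (1 - ‖z‖ ^ 2) * Real.log (Real.exp 1 / (1 - ‖z‖ ^ 2)) < ε

/-- `f` belongs to `VMOA_log`. -/
def InVMOAlog (f : ℂ → ℂ) : Prop :=
  ∀ ε > 0, ∃ r < 1, ∀ a ∈ unitDisc, r < ‖a‖ →
    (Real.log (Real.exp 1 / (1 - ‖a‖ ^ 2))) ^ 2 * bmoaSemi f a < ε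

/-- Hyperbolic midpoint of the segment `[0, w]`. -/
def wstar (w : ℂ) : ℂ :=
  (((1 - Real.sqrt (1 - ‖w‖ ^ 2)) / ‖w‖ ^ 2 : ℝ) : ℂ) * w

/-- The building-block function `β_w(z) = Log(e / (1 + conj(w) φ_{w*}(z)))`. -/
def betaB (w z : ℂ) : ℂ :=
  Complex.log ((Real.exp 1 : ℂ) / (1 + (starRingEnd ℂ) w * mobius (wstar w) z))

/-- The (invariant) Carleson box `S(I_u)` associated with a point `u ∈ 𝔻 \ {0}`. -/
def carlesonBox (u : ℂ) : Set ℂ :=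
  {z ∈ unitDisc | ((starRingEnd ℂ) u * mobius u z).re ≤ 0}

/-- The generalized Volterra operator `T_g f(z) = ∫₀^z f(ζ) g'(ζ) dζ`. -/
def volterra (g f : ℂ → ℂ) (z : ℂ) : ℂ :=
  z * ∫ t in (0:ℝ)..1, f ((t : ℂ) * z) * deriv g ((t : ℂ) * z)

theorem mem_unitDisc {z : ℂ} : z ∈ unitDisc ↔ ‖z‖ < 1 := by
  simp [unitDisc]

theorem one_sub_norm_sq_pos {z : ℂ} (hz : z ∈ unitDisc) : 0 < 1 - ‖z‖ ^ 2 := by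
  have := mem_unitDisc.1 hz
  nlinarith [norm_nonneg z]

theorem hasDerivAt_volterra {g F : ℂ → ℂ} (hg : DifferentiableOn ℂ g unitDisc)
    (hF : DifferentiableOn ℂ F unitDisc) {z : ℂ} (hz : z ∈ unitDisc) :
    HasDerivAt (volterra g F) (F z * deriv g z) z := by
  have hopen : IsOpen unitDisc := Metric.isOpen_ball
  have hd : DifferentiableOn ℂ (fun z => F z * deriv g z) unitDisc :=
    hF.mul (hg.deriv hopen)
  obtain ⟨P, hP⟩ := DifferentiableOn.isExactOn_ball hd
  have key : ∀ w ∈ unitDisc, volterra g F w = P w - P 0 := by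
    intro w hw
    have hmem : ∀ t ∈ uIcc (0 : ℝ) 1, (t : ℂ) * w ∈ unitDisc := by
      intro t ht
      rw [uIcc_of_le zero_le_one] at ht
      rw [mem_unitDisc] at hw ⊢
      rw [norm_mul, Complex.norm_real, Real.norm_eq_abs, abs_of_nonneg ht.1]
      nlinarith [norm_nonneg w, ht.1, ht.2]
    have hline : Continuous fun t : ℝ => (t : ℂ) * w := by fun_prop
    have hcont : ContinuousOn
        (fun t : ℝ => F ((t : ℂ) * w) * deriv g ((t : ℂ) * w)) (uIcc 0 1) :=
      hd.continuousOn.comp hline.continuousOn hmem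
    have hderiv : ∀ t ∈ uIcc (0 : ℝ) 1, HasDerivAt (fun t : ℝ => P ((t : ℂ) * w))
        ((F ((t : ℂ) * w) * deriv g ((t : ℂ) * w)) * w) t := by
      intro t ht
      have h1 : HasDerivAt (fun s : ℂ => s * w) w (t : ℂ) := by
        simpa using (hasDerivAt_id (t : ℂ)).mul_const w
      exact (HasDerivAt.comp (t : ℂ) (hP _ (hmem t ht)) h1).comp_ofReal
    have hFTC := intervalIntegral.integral_eq_sub_of_hasDerivAt hderiv
      ((hcont.mul continuousOn_const).intervalIntegrable)
    rw [intervalIntegral.integral_mul_const] at hFTC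
    simp only [ofReal_one, one_mul, ofReal_zero, zero_mul] at hFTC
    rw [volterra, mul_comm, hFTC]
  refine ((hP z hz).sub_const (P 0)).congr_of_eventuallyEq ?_
  filter_upwards [hopen.mem_nhds hz] with w hw using key w hw

theorem blochSemi_volterra {g F : ℂ → ℂ} (hg : DifferentiableOn ℂ g unitDisc)
    (hF : DifferentiableOn ℂ F unitDisc) {z : ℂ} (hz : z ∈ unitDisc) :
    blochSemi (volterra g F) z = ‖F z‖ * blochSemi g z := by
  rw [blochSemi, (hasDerivAt_volterra hg hF hz).deriv, norm_mul, blochSemi, mul_assoc]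

theorem blochSemi_nonneg (f : ℂ → ℂ) {z : ℂ} (hz : z ∈ unitDisc) : 0 ≤ blochSemi f z :=
  mul_nonneg (norm_nonneg _) (one_sub_norm_sq_pos hz).le

/-- The logarithmic weight `log (e / (1 - |z|²))`. -/
def logWeight (z : ℂ) : ℝ := Real.log (Real.exp 1 / (1 - ‖z‖ ^ 2))

theorem logWeight_eq {z : ℂ} (hz : z ∈ unitDisc) :
    logWeight z = 1 - Real.log (1 - ‖z‖ ^ 2) := by
  rw [logWeight, Real.log_div (Real.exp_pos 1).ne' (one_sub_norm_sq_pos hz).ne', Real.log_exp]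

theorem one_le_logWeight {z : ℂ} (hz : z ∈ unitDisc) : 1 ≤ logWeight z := by
  rw [logWeight_eq hz]
  have := Real.log_nonpos (one_sub_norm_sq_pos hz).le (by nlinarith [norm_nonneg z])
  linarith

theorem logWeight_le {z : ℂ} {r : ℝ} (hz : ‖z‖ ≤ r) (hr : r < 1) :
    logWeight z ≤ 1 - Real.log (1 - r ^ 2) := by
  have hz1 : z ∈ unitDisc := mem_unitDisc.2 (hz.trans_lt hr)
  rw [logWeight_eq hz1]
  have h0 := norm_nonneg z
  have := Real.log_le_log (x := 1 - r ^ 2) (y := 1 - ‖z‖ ^ 2) (by nlinarith) (by nlinarith)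
  linarith

theorem exists_lt_logWeight (K : ℝ) :
    ∃ r < 1, ∀ z ∈ unitDisc, r < ‖z‖ → K < logWeight z := by
  refine ⟨1 - Real.exp (1 - K) / 2, by linarith [Real.exp_pos (1 - K)], fun z hz hr => ?_⟩
  rw [logWeight_eq hz]
  have h1 : 1 - ‖z‖ ^ 2 < Real.exp (1 - K) := by
    nlinarith [mem_unitDisc.1 hz, norm_nonneg z]
  have := Real.log_lt_log (one_sub_norm_sq_pos hz) h1
  rw [Real.log_exp] at this
  linarith

/-- If `g ∈ 𝓑 \ 𝓑_{log,0}`, there are points `w` arbitrarily close to the circle and scalars `s`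
for which `s * min (logWeight z) (logWeight w)` is dominated by the reciprocal of `blochSemi g`,
and comparable to it at `z = w`. -/
theorem exists_truncated_logWeight {g : ℂ → ℂ} (hg : IsBloch g) (hgn : ¬ InBlochLog0 g) :
    ∃ D > 0, ∃ c > 0, ∀ r < 1, ∃ w ∈ unitDisc, r < ‖w‖ ∧ ∃ s, 0 ≤ s ∧ s ≤ D ∧
      (∀ z ∈ unitDisc, s * blochSemi g z * min (logWeight z) (logWeight w) ≤ D) ∧
      c ≤ s * blochSemi g w * logWeight w := by
  by_cases hb : ∃ B : ℝ, ∀ z ∈ unitDisc, blochSemi g z * logWeight z ≤ B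
  · obtain ⟨B, hB⟩ := hb
    simp only [InBlochLog0, not_forall, not_exists, not_and, exists_prop, not_lt] at hgn
    obtain ⟨ε, hε, h⟩ := hgn
    refine ⟨max B 1, by positivity, ε, hε, fun r hr => ?_⟩
    obtain ⟨w, hw, hrw, hle⟩ := h r hr
    refine ⟨w, hw, hrw, 1, zero_le_one, le_max_right _ _, fun z hz => ?_, ?_⟩
    · rw [one_mul]
      exact (mul_le_mul_of_nonneg_left (min_le_left _ _) (blochSemi_nonneg g hz)).trans
        ((hB z hz).trans (le_max_left _ _))
    · rw [one_mul]
      exact hle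
  · push Not at hb
    refine ⟨1, one_pos, 1 / 2, by norm_num, fun r hr => ?_⟩
    obtain ⟨C, hC⟩ := hg.2
    have hC0 : 0 ≤ C := (blochSemi_nonneg g (z := 0) (by simp [mem_unitDisc])).trans
      (hC 0 (by simp [mem_unitDisc]))
    set r' := max r 0
    have hr' : r' < 1 := max_lt hr one_pos
    set K := 1 - Real.log (1 - r' ^ 2)
    have hK : 0 ≤ K := by
      have := (one_le_logWeight (z := 0) (by simp [mem_unitDisc])).trans
        (logWeight_le (r := r') (by simp [r']) hr')
      linarith
    obtain ⟨z₀, hz₀, hlt⟩ := hb (2 * (C * K) + 2)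
    set H := logWeight z₀
    have hH : 1 ≤ H := one_le_logWeight hz₀
    set S := (fun z => blochSemi g z * min (logWeight z) H) '' unitDisc
    have hSb : BddAbove S := by
      refine ⟨C * H, ?_⟩
      rintro _ ⟨z, hz, rfl⟩
      exact mul_le_mul (hC z hz) (min_le_right _ _)
        (le_min (by linarith [one_le_logWeight hz]) (by linarith)) hC0
    set A := sSup S
    have hA : ∀ z ∈ unitDisc, blochSemi g z * min (logWeight z) H ≤ A := fun z hz =>
      le_csSup hSb ⟨z, hz, rfl⟩
    have hA2 : 2 * (C * K) + 2 < A := by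
      have := hA z₀ hz₀
      rw [min_self] at this
      linarith
    have hCK : 0 ≤ C * K := by positivity
    have hA0 : 0 < A := by linarith
    obtain ⟨_, ⟨w, hw, rfl⟩, hwA⟩ := exists_lt_of_lt_csSup (s := S) ⟨_, z₀, hz₀, rfl⟩
      (show A / 2 < sSup S by linarith)
    simp only at hwA
    have hhw := one_le_logWeight hw
    have hhw0 : 0 < logWeight w := by linarith
    have hm0 : 0 ≤ min (logWeight w) H := le_min (by linarith) (by linarith)
    refine ⟨w, hw, ?_, min (logWeight w) H / logWeight w / A, by positivity, ?_, ?_, ?_⟩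
    · by_contra! hle
      have h1 : logWeight w ≤ K := logWeight_le (hle.trans (le_max_left _ _)) hr'
      have h2 := mul_le_mul (hC w hw) ((min_le_left _ H).trans h1) hm0 hC0
      linarith
    · rw [div_div, div_le_one (by positivity)]
      have := min_le_left (logWeight w) H
      nlinarith
    · intro z hz
      have hhz := one_le_logWeight hz
      have hmz0 : 0 ≤ min (logWeight z) (logWeight w) := le_min (by linarith) (by linarith)
      have h1 : min (logWeight w) H * min (logWeight z) (logWeight w)
          ≤ min (logWeight z) H * logWeight w := by
        rcases le_total (logWeight z) H with h | h
        · rw [min_eq_left h, mul_comm]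
          exact mul_le_mul (min_le_left _ _) (min_le_left _ _) hm0 (by linarith)
        · rw [min_eq_right h]
          exact mul_le_mul (min_le_right _ _) (min_le_right _ _) hmz0 (by linarith)
      have h2 := hA z hz
      have h3 := mul_le_mul_of_nonneg_left h1 (blochSemi_nonneg g hz)
      have h4 := mul_le_mul_of_nonneg_right h2 hhw0.le
      rw [div_div, div_mul_eq_mul_div, div_mul_eq_mul_div, div_le_one (by positivity)]
      linarith
    · have : min (logWeight w) H / logWeight w / A * blochSemi g w * logWeight w
          = blochSemi g w * min (logWeight w) H / A := by
        field_simp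
      rw [this, le_div_iff₀ hA0]
      linarith

theorem norm_one_sub_log_one_sub_le {u : ℂ} {ρ : ℝ} (hu : ‖u‖ ≤ ρ) (hρ : ρ < 1) :
    ‖1 - Complex.log (1 - u)‖ ≤ 4 * (1 - Real.log (1 - ρ ^ 2)) := by
  have hu0 := norm_nonneg u
  have hre : 0 ≤ (1 - u).re := by
    have := (Complex.abs_re_le_norm u).trans hu
    rw [Complex.sub_re, Complex.one_re]
    linarith [le_abs_self u.re]
  have harg := Complex.abs_arg_le_pi_div_two_iff.2 hre
  have hlow : (1 - ρ ^ 2) / 2 ≤ ‖1 - u‖ := by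
    have := norm_sub_norm_le (1 : ℂ) u
    rw [norm_one] at this
    nlinarith
  have hup : ‖1 - u‖ ≤ 2 := by
    have := norm_sub_le (1 : ℂ) u
    rw [norm_one] at this
    linarith
  have hpos : 0 < 1 - ρ ^ 2 := by nlinarith
  have hl1 := Real.log_le_log (by positivity) hlow
  rw [Real.log_div hpos.ne' two_ne_zero] at hl1
  have hl2 := Real.log_le_log (by linarith) hup
  have hl3 := Real.log_nonpos hpos.le (by nlinarith)
  have h2 := Real.log_two_lt_d9
  have hpi := Real.pi_lt_d2
  refine (Complex.norm_le_abs_re_add_abs_im _).trans ?_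
  rw [Complex.sub_re, Complex.sub_im, Complex.log_re, Complex.log_im, Complex.one_re,
    Complex.one_im, zero_sub, abs_neg, abs_of_nonneg (by linarith)]
  linarith

theorem norm_conj_mul_le_left {w z : ℂ} (hz : z ∈ unitDisc) :
    ‖(starRingEnd ℂ) w * z‖ ≤ ‖w‖ := by
  rw [norm_mul, Complex.norm_conj]
  nlinarith [norm_nonneg w, mem_unitDisc.1 hz]

theorem norm_conj_mul_le_right {w z : ℂ} (hw : w ∈ unitDisc) :
    ‖(starRingEnd ℂ) w * z‖ ≤ ‖z‖ := by
  rw [norm_mul, Complex.norm_conj]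
  nlinarith [norm_nonneg z, mem_unitDisc.1 hw]

/-- The function `log (e / (1 - conj(w) z))`. -/
def kernelLog (w z : ℂ) : ℂ := 1 - Complex.log (1 - (starRingEnd ℂ) w * z)

theorem norm_kernelLog_le {w z : ℂ} (hw : w ∈ unitDisc) (hz : z ∈ unitDisc) :
    ‖kernelLog w z‖ ≤ 4 * min (logWeight z) (logWeight w) := by
  rw [mul_min_of_nonneg _ _ (by norm_num), logWeight_eq hz, logWeight_eq hw]
  exact le_min (norm_one_sub_log_one_sub_le (norm_conj_mul_le_right hw) (mem_unitDisc.1 hz))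
    (norm_one_sub_log_one_sub_le (norm_conj_mul_le_left hz) (mem_unitDisc.1 hw))

theorem kernelLog_self {w : ℂ} (hw : w ∈ unitDisc) : kernelLog w w = (logWeight w : ℂ) := by
  rw [kernelLog, Complex.conj_mul', logWeight_eq hw, Complex.ofReal_sub,
    Complex.ofReal_log (one_sub_norm_sq_pos hw).le]
  simp

theorem norm_one_sub_conj_mul_ge_left {w z : ℂ} (hz : z ∈ unitDisc) :
    1 - ‖w‖ ≤ ‖1 - (starRingEnd ℂ) w * z‖ := by
  have := norm_sub_norm_le (1 : ℂ) ((starRingEnd ℂ) w * z)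
  rw [norm_one] at this
  linarith [norm_conj_mul_le_left (w := w) hz]

theorem norm_one_sub_conj_mul_ge_right {w z : ℂ} (hw : w ∈ unitDisc) :
    1 - ‖z‖ ≤ ‖1 - (starRingEnd ℂ) w * z‖ := by
  have := norm_sub_norm_le (1 : ℂ) ((starRingEnd ℂ) w * z)
  rw [norm_one] at this
  linarith [norm_conj_mul_le_right (z := z) hw]

theorem hasDerivAt_kernelLog {w z : ℂ} (hw : w ∈ unitDisc) (hz : z ∈ unitDisc) :
    HasDerivAt (kernelLog w) ((starRingEnd ℂ) w / (1 - (starRingEnd ℂ) w * z)) z := by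
  have hslit : 1 - (starRingEnd ℂ) w * z ∈ slitPlane := by
    have := norm_conj_mul_le_right (z := z) hw
    exact sub_eq_add_neg (1 : ℂ) _ ▸ Complex.mem_slitPlane_of_norm_lt_one
      (by rw [norm_neg]; exact this.trans_lt (mem_unitDisc.1 hz))
  have h := ((((hasDerivAt_id z).const_mul ((starRingEnd ℂ) w)).const_sub 1).clog hslit).const_sub 1
  exact h.congr_deriv (by simp [neg_div])

/-- The test function `s * log (e / (1 - conj(w) z))² / log (e / (1 - |w|²))`. -/
def logHump (s : ℝ) (w z : ℂ) : ℂ := ((s / logWeight w : ℝ) : ℂ) * kernelLog w z ^ 2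

theorem norm_logHump {s : ℝ} (hs : 0 ≤ s) {w : ℂ} (hw : w ∈ unitDisc) (z : ℂ) :
    ‖logHump s w z‖ = s / logWeight w * ‖kernelLog w z‖ ^ 2 := by
  have := one_le_logWeight hw
  rw [logHump, norm_mul, norm_pow, Complex.norm_real, Real.norm_of_nonneg (by positivity)]

theorem hasDerivAt_logHump (s : ℝ) {w z : ℂ} (hw : w ∈ unitDisc) (hz : z ∈ unitDisc) :
    HasDerivAt (logHump s w) (((s / logWeight w : ℝ) : ℂ) *
      (2 * kernelLog w z * ((starRingEnd ℂ) w / (1 - (starRingEnd ℂ) w * z)))) z := by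
  exact (((hasDerivAt_kernelLog hw hz).pow 2).const_mul ((s / logWeight w : ℝ) : ℂ)).congr_deriv
    (by simp)

theorem blochSemi_logHump {s : ℝ} (hs : 0 ≤ s) {w z : ℂ} (hw : w ∈ unitDisc)
    (hz : z ∈ unitDisc) :
    blochSemi (logHump s w) z = 2 * (s / logWeight w) * ‖kernelLog w z‖ *
      (‖w‖ * (1 - ‖z‖ ^ 2) / ‖1 - (starRingEnd ℂ) w * z‖) := by
  have := one_le_logWeight hw
  rw [blochSemi, (hasDerivAt_logHump s hw hz).deriv, norm_mul, norm_mul, norm_mul, norm_div,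
    Complex.norm_real, Real.norm_of_nonneg (by positivity), Complex.norm_conj, Complex.norm_two]
  ring

theorem exists_hump {g : ℂ → ℂ} (hg : IsBloch g) (hgn : ¬ InBlochLog0 g)
    (hg0 : ∀ ε > 0, ∃ r < 1, ∀ z ∈ unitDisc, r < ‖z‖ → blochSemi g z < ε) :
    ∃ D > 0, ∃ c > 0, ∀ r < 1, ∀ δ > 0, ∃ f : ℂ → ℂ, ∃ M ρ : ℝ, ∃ w ∈ unitDisc,
      ρ < 1 ∧ r < ‖w‖ ∧ ‖w‖ < ρ ∧ (1 + r) / 2 ≤ ρ ∧ DifferentiableOn ℂ f unitDisc ∧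
      (∀ z ∈ unitDisc, ‖f z‖ ≤ M) ∧
      (∀ z ∈ unitDisc, blochSemi f z ≤ D ∧ ‖f z‖ * blochSemi g z ≤ D) ∧
      (∀ z ∈ unitDisc, ‖z‖ ≤ r →
        ‖f z‖ ≤ δ ∧ blochSemi f z ≤ δ ∧ ‖f z‖ * blochSemi g z ≤ δ) ∧
      (∀ z ∈ unitDisc, ρ ≤ ‖z‖ → blochSemi f z ≤ δ ∧ ‖f z‖ * blochSemi g z ≤ δ) ∧
      c ≤ ‖f w‖ * blochSemi g w := by
  obtain ⟨D, hD, c, hc, hsel⟩ := exists_truncated_logWeight hg hgn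
  obtain ⟨C, hC⟩ := hg.2
  have h0 : (0 : ℂ) ∈ unitDisc := by simp [mem_unitDisc]
  have hC0 : 0 ≤ C := (blochSemi_nonneg g h0).trans (hC 0 h0)
  refine ⟨16 * D, by positivity, c, hc, fun r hr δ hδ => ?_⟩
  set r' := max r 0
  have hr' : r' < 1 := max_lt hr one_pos
  set K := 1 - Real.log (1 - r' ^ 2)
  have hK : 1 ≤ K := (one_le_logWeight h0).trans (logWeight_le (by simp [r']) hr')
  obtain ⟨r₁, hr₁, hlarge⟩ := exists_lt_logWeight (16 * D * K ^ 2 * (1 + C) / δ)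
  obtain ⟨w, hw, hrw, s, hs0, hsD, hsup, hlow⟩ := hsel (max r r₁) (max_lt hr hr₁)
  have hhw := one_le_logWeight hw
  have hw1 := mem_unitDisc.1 hw
  have hw0 := norm_nonneg w
  have hbig := hlarge w hw ((le_max_right _ _).trans_lt hrw)
  rw [div_lt_iff₀ hδ] at hbig
  set h := logWeight w
  have hh0 : 0 < h := by linarith
  set M := 16 * D * h
  have hM : 0 < M := by positivity
  obtain ⟨r₂, hr₂, hsmall⟩ := hg0 (δ / M) (by positivity)
  have hq : ∀ z ∈ unitDisc, ‖w‖ * (1 - ‖z‖ ^ 2) / ‖1 - (starRingEnd ℂ) w * z‖ ≤ 2 := by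
    intro z hz
    have hz1 := mem_unitDisc.1 hz
    have hz0 := norm_nonneg z
    have h1 := norm_one_sub_conj_mul_ge_right (z := z) hw
    rw [div_le_iff₀ (by linarith)]
    have := one_sub_norm_sq_pos hz
    nlinarith
  have hq' : ∀ z ∈ unitDisc, ‖w‖ * (1 - ‖z‖ ^ 2) / ‖1 - (starRingEnd ℂ) w * z‖ ≤
      (1 - ‖z‖ ^ 2) / (1 - ‖w‖) := by
    intro z hz
    have := one_sub_norm_sq_pos hz
    have h1 := norm_one_sub_conj_mul_ge_left (w := w) hz
    have h2 : ‖w‖ * (1 - ‖z‖ ^ 2) ≤ 1 - ‖z‖ ^ 2 := by nlinarith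
    exact div_le_div₀ this.le h2 (by linarith) h1
  have hq0 : ∀ z ∈ unitDisc, 0 ≤ ‖w‖ * (1 - ‖z‖ ^ 2) / ‖1 - (starRingEnd ℂ) w * z‖ := by
    intro z hz
    have := one_sub_norm_sq_pos hz
    positivity
  have hLz : ∀ z ∈ unitDisc, ‖kernelLog w z‖ ≤ 4 * logWeight z := fun z hz =>
    (norm_kernelLog_le hw hz).trans (by linarith [min_le_left (logWeight z) (logWeight w)])
  have hLw : ∀ z ∈ unitDisc, ‖kernelLog w z‖ ≤ 4 * h := fun z hz =>
    (norm_kernelLog_le hw hz).trans (by linarith [min_le_right (logWeight z) (logWeight w)])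
  have hfM : ∀ z ∈ unitDisc, ‖logHump s w z‖ ≤ M := by
    intro z hz
    rw [norm_logHump hs0 hw]
    calc s / h * ‖kernelLog w z‖ ^ 2 ≤ D / h * (4 * h) ^ 2 := by
          gcongr
          exact hLw z hz
      _ = M := by simp only [M]; field_simp; norm_num
  have hb : ∀ z ∈ unitDisc, ∀ Q, ‖w‖ * (1 - ‖z‖ ^ 2) / ‖1 - (starRingEnd ℂ) w * z‖ ≤ Q →
      ∀ L, ‖kernelLog w z‖ ≤ L → blochSemi (logHump s w) z ≤ 2 * (D / h) * L * Q := by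
    intro z hz Q hQ L hL
    rw [blochSemi_logHump hs0 hw hz]
    have := hq0 z hz
    have hL0 := (norm_nonneg _).trans hL
    gcongr
  set ρ := max (max ((1 + r) / 2) ((1 + ‖w‖) / 2))
    (max ((1 + r₂) / 2) (1 - δ * (1 - ‖w‖) / (16 * D)))
  have hρ1 : ρ < 1 := by
    have : 0 < δ * (1 - ‖w‖) / (16 * D) := by
      have : 0 < 1 - ‖w‖ := by linarith
      positivity
    exact max_lt (max_lt (by linarith) (by linarith)) (max_lt (by linarith) (by linarith))
  have hρa : (1 + r) / 2 ≤ ρ := (le_max_left _ _).trans (le_max_left _ _)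
  have hρb : (1 + ‖w‖) / 2 ≤ ρ := (le_max_right _ _).trans (le_max_left _ _)
  have hρc : (1 + r₂) / 2 ≤ ρ := (le_max_left _ _).trans (le_max_right _ _)
  have hρd : 1 - δ * (1 - ‖w‖) / (16 * D) ≤ ρ := (le_max_right _ _).trans (le_max_right _ _)
  refine ⟨logHump s w, M, ρ, w, hw, hρ1, (le_max_left _ _).trans_lt hrw, by linarith, hρa,
    fun z hz => (hasDerivAt_logHump s hw hz).differentiableAt.differentiableWithinAt, hfM,
    fun z hz => ⟨?_, ?_⟩, fun z hz hzr => ?_, fun z hz hzρ => ⟨?_, ?_⟩, ?_⟩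
  · refine (hb z hz _ (hq z hz) _ (hLw z hz)).trans (le_of_eq ?_)
    field_simp
    norm_num
  · rw [norm_logHump hs0 hw]
    have hm0 : 0 ≤ min (logWeight z) h := le_min (by linarith [one_le_logWeight hz]) hh0.le
    have hG := blochSemi_nonneg g hz
    calc s / h * ‖kernelLog w z‖ ^ 2 * blochSemi g z
        ≤ s / h * ((4 * min (logWeight z) h) * (4 * h)) * blochSemi g z := by
          rw [pow_two]
          gcongr
          · exact norm_kernelLog_le hw hz
          · exact hLw z hz
      _ = 16 * (s * blochSemi g z * min (logWeight z) h) := by field_simp; ring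
      _ ≤ 16 * D := by linarith [hsup z hz]
  · have hzK : logWeight z ≤ K := logWeight_le (hzr.trans (le_max_left _ _)) hr'
    have hLK : ‖kernelLog w z‖ ≤ 4 * K := (hLz z hz).trans (by linarith)
    have hf1 : ‖logHump s w z‖ * (1 + C) ≤ δ := by
      rw [norm_logHump hs0 hw]
      calc s / h * ‖kernelLog w z‖ ^ 2 * (1 + C) ≤ D / h * (4 * K) ^ 2 * (1 + C) := by gcongr
        _ = 16 * D * K ^ 2 * (1 + C) / h := by ring
        _ ≤ δ := by
          rw [div_le_iff₀ hh0]
          linarith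
    have hn := norm_nonneg (logHump s w z)
    refine ⟨by nlinarith, ?_, ?_⟩
    · refine (hb z hz _ (hq z hz) _ hLK).trans ?_
      calc 2 * (D / h) * (4 * K) * 2 = 16 * D * (K * 1) * 1 / h := by ring
        _ ≤ 16 * D * (K * K) * (1 + C) / h := by
          gcongr
          linarith
        _ ≤ δ := by
          rw [div_le_iff₀ hh0, ← pow_two]
          linarith
    · have := mul_le_mul_of_nonneg_left (hC z hz) hn
      linarith
  · refine (hb z hz _ (hq' z hz) _ (hLw z hz)).trans ?_
    have hz1 := mem_unitDisc.1 hz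
    have h1 : 1 - ‖z‖ ≤ δ * (1 - ‖w‖) / (16 * D) := by linarith
    rw [le_div_iff₀ (by positivity)] at h1
    have h2 : 1 - ‖z‖ ^ 2 ≤ 2 * (1 - ‖z‖) := by nlinarith
    have h3 : 2 * (D / h) * (4 * h) * ((1 - ‖z‖ ^ 2) / (1 - ‖w‖))
        = 8 * D * (1 - ‖z‖ ^ 2) / (1 - ‖w‖) := by
      field_simp
      ring
    rw [h3, div_le_iff₀ (by linarith)]
    nlinarith
  · have h1 := (hsmall z hz (by linarith)).le
    calc ‖logHump s w z‖ * blochSemi g z ≤ M * (δ / M) :=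
          mul_le_mul (hfM z hz) h1 (blochSemi_nonneg g hz) hM.le
      _ = δ := by field_simp
  · rw [norm_logHump hs0 hw, kernelLog_self hw, Complex.norm_real, Real.norm_of_nonneg hh0.le]
    refine hlow.trans (le_of_eq ?_)
    change s * blochSemi g w * h = s / h * h ^ 2 * blochSemi g w
    field_simp

/-- If `R k` increases to `1`, then a point `t < 1` lies in at most one of the intervals
`(R k, R (k + 1))`. -/
theorem exists_annulus_index {R : ℕ → ℝ} (hmono : Monotone R)
    (hlim : Tendsto R atTop (nhds 1)) {t : ℝ} (ht : t < 1) :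
    ∃ m, ∀ k, k ≠ m → t ≤ R k ∨ R (k + 1) ≤ t := by
  have hex : ∃ n, t < R n := (hlim.eventually (lt_mem_nhds ht)).exists
  refine ⟨Nat.find hex - 1, fun k hk => ?_⟩
  rcases lt_or_ge k (Nat.find hex) with h | h
  · exact Or.inr (not_lt.1 (Nat.find_min hex (by omega)))
  · exact Or.inl ((Nat.find_spec hex).le.trans (hmono h))

theorem exists_hump_sequence {g : ℂ → ℂ} (hg : IsBloch g) (hgn : ¬ InBlochLog0 g)
    (hg0 : ∀ ε > 0, ∃ r < 1, ∀ z ∈ unitDisc, r < ‖z‖ → blochSemi g z < ε) :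
    ∃ D > 0, ∃ c > 0, ∃ (f : ℕ → ℂ → ℂ) (M R : ℕ → ℝ) (w : ℕ → ℂ),
      Monotone R ∧ Tendsto R atTop (nhds 1) ∧
      ∀ k, w k ∈ unitDisc ∧ R k < ‖w k‖ ∧ ‖w k‖ < R (k + 1) ∧
        DifferentiableOn ℂ (f k) unitDisc ∧ (∀ z ∈ unitDisc, ‖f k z‖ ≤ M k) ∧
        (∀ z ∈ unitDisc, blochSemi (f k) z ≤ D ∧ ‖f k z‖ * blochSemi g z ≤ D) ∧
        (∀ z ∈ unitDisc, ‖z‖ ≤ R k → ‖f k z‖ ≤ c / 2 / 2 / 2 ^ k ∧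
          blochSemi (f k) z ≤ c / 2 / 2 / 2 ^ k ∧
          ‖f k z‖ * blochSemi g z ≤ c / 2 / 2 / 2 ^ k) ∧
        (∀ z ∈ unitDisc, R (k + 1) ≤ ‖z‖ → blochSemi (f k) z ≤ c / 2 / 2 / 2 ^ k ∧
          ‖f k z‖ * blochSemi g z ≤ c / 2 / 2 / 2 ^ k) ∧
        c ≤ ‖f k (w k)‖ * blochSemi g (w k) := by
  obtain ⟨D, hD, c, hc, H⟩ := exists_hump hg hgn hg0
  have H' := fun (k : ℕ) (r : Iio (1 : ℝ)) => H r r.2 (c / 2 / 2 / 2 ^ k) (by positivity)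
  choose f M ρ w hw hρ1 hrw hwρ hρ hrest using H'
  let S : ℕ → Iio (1 : ℝ) :=
    fun n => Nat.rec ⟨0, mem_Iio.2 one_pos⟩ (fun k r => ⟨ρ k r, hρ1 k r⟩) n
  have hS : ∀ k, (S (k + 1)).1 = ρ k (S k) := fun k => rfl
  have hlow : ∀ k, 1 - (1 / 2 : ℝ) ^ k ≤ (S k).1 := by
    intro k
    induction k with
    | zero => simp [S]
    | succ k ih =>
      have := hρ k (S k)
      rw [hS, pow_succ]
      linarith
  refine ⟨D, hD, c, hc, fun k => f k (S k), fun k => M k (S k), fun k => (S k).1,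
    fun k => w k (S k), ?_, ?_, fun k => ⟨hw k _, hrw k _, hwρ k _, hrest k _⟩⟩
  · refine monotone_nat_of_le_succ fun k => ?_
    rw [hS]
    exact ((hrw k (S k)).trans (hwρ k (S k))).le
  · refine tendsto_of_tendsto_of_tendsto_of_le_of_le ?_ tendsto_const_nhds hlow
      (fun k => (S k).2.le)
    simpa using (tendsto_pow_atTop_nhds_zero_of_lt_one (r := (1 / 2 : ℝ)) (by norm_num)
      (by norm_num)).const_sub 1

/-- If all but one term of a series are dominated by `c / 2 / 2 / 2 ^ k` and the remaining one by
`D`, then the sum is at most `c / 2 + D`. -/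
theorem norm_le_of_hasSum_of_forall_ne {a : ℕ → ℂ} {A : ℂ} (ha : HasSum a A) {c D : ℝ}
    (hc : 0 ≤ c) {m : ℕ} (hne : ∀ k, k ≠ m → ‖a k‖ ≤ c / 2 / 2 / 2 ^ k) (hm : ‖a m‖ ≤ D) :
    ‖A‖ ≤ c / 2 + D := by
  refine ha.norm_le_of_bounded ((hasSum_geometric_two' (c / 2)).add (hasSum_ite_eq m D))
    fun k => ?_
  have h0 : 0 ≤ c / 2 / 2 / 2 ^ k := by positivity
  split_ifs with h
  · subst h
    linarith
  · linarith [hne k h]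

theorem le_norm_of_hasSum_of_forall_ne {a : ℕ → ℂ} {A : ℂ} (ha : HasSum a A) {c : ℝ}
    (hc : 0 ≤ c) {m : ℕ} (hne : ∀ k, k ≠ m → ‖a k‖ ≤ c / 2 / 2 / 2 ^ k) (hm : c ≤ ‖a m‖) :
    c / 2 ≤ ‖A‖ := by
  have h1 : ‖A - a m‖ ≤ c / 2 := by
    refine (ha.sub (hasSum_ite_eq m (a m))).norm_le_of_bounded (hasSum_geometric_two' (c / 2))
      fun k => ?_
    have h0 : 0 ≤ c / 2 / 2 / 2 ^ k := by positivity
    split_ifs with h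
    · subst h
      simpa using h0
    · simpa using hne k h
  have := norm_sub_norm_le (a m) A
  rw [norm_sub_rev] at this
  linarith

theorem exists_bloch_of_littleBloch_symbol {g : ℂ → ℂ} (hg : IsBloch g) (hgn : ¬ InBlochLog0 g)
    (hg0 : ∀ ε > 0, ∃ r < 1, ∀ z ∈ unitDisc, r < ‖z‖ → blochSemi g z < ε) :
    ∃ F : ℂ → ℂ, IsBloch F ∧ IsBloch (volterra g F) ∧ ¬ IsLittleBloch (volterra g F) := by
  obtain ⟨D, hD, c, hc, f, M, R, w, hmono, hlim, hf⟩ := exists_hump_sequence hg hgn hg0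
  choose hw hRw hwR hdiff hM hbd hin hout hlow using hf
  have hopen : IsOpen unitDisc := Metric.isOpen_ball
  have hlocal : ∀ z ∈ unitDisc, ∃ U ⊆ unitDisc, IsOpen U ∧ z ∈ U ∧ ∃ u : ℕ → ℝ, Summable u ∧
      ∀ k, ∀ ζ ∈ U, ‖f k ζ‖ ≤ u k := by
    intro z hz
    obtain ⟨n, hn⟩ := (hlim.eventually (lt_mem_nhds (mem_unitDisc.1 hz))).exists
    refine ⟨unitDisc ∩ Metric.ball 0 (R n), inter_subset_left, hopen.inter Metric.isOpen_ball,
      ⟨hz, by simpa using hn⟩, fun k => if k < n then M k else c / 2 / 2 / 2 ^ k, ?_, ?_⟩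
    · refine (hasSum_geometric_two' (c / 2)).summable.congr_cofinite ?_
      rw [Nat.cofinite_eq_atTop]
      filter_upwards [eventually_ge_atTop n] with k hk
      rw [if_neg (by omega)]
    · rintro k ζ ⟨hζ, hζn⟩
      simp only
      split_ifs with hk
      · exact hM k ζ hζ
      · rw [mem_ball_zero_iff] at hζn
        exact (hin k ζ hζ (hζn.le.trans (hmono (by omega)))).1
  set F : ℂ → ℂ := fun z => ∑' k, f k z
  have hFdiff : DifferentiableOn ℂ F unitDisc := by
    intro z hz
    obtain ⟨U, hU, hUo, hzU, u, hu, hle⟩ := hlocal z hz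
    have hd := differentiableOn_tsum_of_summable_norm hu (fun k => (hdiff k).mono hU) hUo hle
    exact (hd.differentiableAt (hUo.mem_nhds hzU)).differentiableWithinAt
  have hFsum : ∀ z ∈ unitDisc, HasSum (fun k => f k z) (F z) := by
    intro z hz
    obtain ⟨U, hU, hUo, hzU, u, hu, hle⟩ := hlocal z hz
    exact (Summable.of_norm_bounded hu fun k => hle k z hzU).hasSum
  have hFderiv : ∀ z ∈ unitDisc, HasSum (fun k => deriv (f k) z) (deriv F z) := by
    intro z hz
    obtain ⟨U, hU, hUo, hzU, u, hu, hle⟩ := hlocal z hz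
    exact hasSum_deriv_of_summable_norm hu (fun k => (hdiff k).mono hU) hUo hle hzU
  have hnorm : ∀ x : ℂ, ∀ y : ℝ, 0 ≤ y → ‖x * (y : ℂ)‖ = ‖x‖ * y := fun x y hy => by
    rw [norm_mul, Complex.norm_real, Real.norm_of_nonneg hy]
  have hV : ∀ z ∈ unitDisc, blochSemi (volterra g F) z = ‖F z‖ * blochSemi g z :=
    fun z hz => blochSemi_volterra hg.1 hFdiff hz
  refine ⟨F, ⟨hFdiff, c / 2 + D, fun z hz => ?_⟩,
    ⟨fun z hz => (hasDerivAt_volterra hg.1 hFdiff hz).differentiableAt.differentiableWithinAt,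
      c / 2 + D, fun z hz => ?_⟩, fun hlittle => ?_⟩
  · obtain ⟨m, hm⟩ := exists_annulus_index hmono hlim (mem_unitDisc.1 hz)
    have hp := (one_sub_norm_sq_pos hz).le
    have := norm_le_of_hasSum_of_forall_ne ((hFderiv z hz).mul_right ((1 - ‖z‖ ^ 2 : ℝ) : ℂ))
      hc.le (D := D) (m := m) (fun k hk => ?_) ?_
    · rwa [hnorm _ _ hp] at this
    · rw [hnorm _ _ hp]
      exact (hm k hk).elim (fun h => (hin k z hz h).2.1) (fun h => (hout k z hz h).1)
    · rw [hnorm _ _ hp]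
      exact (hbd m z hz).1
  · obtain ⟨m, hm⟩ := exists_annulus_index hmono hlim (mem_unitDisc.1 hz)
    have hp := blochSemi_nonneg g hz
    have := norm_le_of_hasSum_of_forall_ne ((hFsum z hz).mul_right (blochSemi g z : ℂ))
      hc.le (D := D) (m := m) (fun k hk => ?_) ?_
    · rwa [hnorm _ _ hp, ← hV z hz] at this
    · rw [hnorm _ _ hp]
      exact (hm k hk).elim (fun h => (hin k z hz h).2.2) (fun h => (hout k z hz h).2)
    · rw [hnorm _ _ hp]
      exact (hbd m z hz).2
  · obtain ⟨r, hr, hsmall⟩ := hlittle.2 (c / 2) (by positivity)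
    obtain ⟨m, hm⟩ := (hlim.eventually (lt_mem_nhds hr)).exists
    have hp := blochSemi_nonneg g (hw m)
    have := le_norm_of_hasSum_of_forall_ne
      ((hFsum (w m) (hw m)).mul_right (blochSemi g (w m) : ℂ)) hc.le (m := m)
      (fun k hk => ?_) ?_
    · rw [hnorm _ _ hp, ← hV _ (hw m)] at this
      exact absurd (hsmall (w m) (hw m) (hm.trans (hRw m))) (not_lt.2 this)
    · rw [hnorm _ _ hp]
      rcases lt_or_gt_of_ne hk with h | h
      · exact (hout k _ (hw m) ((hmono (by omega)).trans (hRw m).le)).2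
      · exact (hin k _ (hw m) ((hwR m).le.trans (hmono (by omega)))).2.2
    · rw [hnorm _ _ hp]
      exact hlow m

/-- If `g ∈ 𝓑 \ 𝓑_{log,0}`, then there exists `F ∈ 𝓑` with
`T_g F ∈ 𝓑 \ 𝓑₀`. -/
theorem exists_bloch_with_volterra_in_bloch_not_littleBloch
    (g : ℂ → ℂ) (hg : IsBloch g) (hgn : ¬ InBlochLog0 g) :
    ∃ F : ℂ → ℂ, IsBloch F ∧ IsBloch (volterra g F) ∧ ¬ IsLittleBloch (volterra g F) := by
  by_cases hg0 : ∀ ε > 0, ∃ r < 1, ∀ z ∈ unitDisc, r < ‖z‖ → blochSemi g z < ε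
  · exact exists_bloch_of_littleBloch_symbol hg hgn hg0
  · have hdiff : DifferentiableOn ℂ (fun _ : ℂ => (1 : ℂ)) unitDisc := differentiableOn_const 1
    have hV : ∀ z ∈ unitDisc, blochSemi (volterra g fun _ => 1) z = blochSemi g z :=
      fun z hz => by simpa using blochSemi_volterra hg.1 hdiff hz
    obtain ⟨C, hC⟩ := hg.2
    refine ⟨fun _ => 1, ⟨hdiff, 0, fun z _ => by simp [blochSemi]⟩,
      ⟨fun z hz => (hasDerivAt_volterra hg.1 hdiff hz).differentiableAt.differentiableWithinAt,
        C, fun z hz => (hV z hz).trans_le (hC z hz)⟩, fun hlittle => hg0 fun ε hε => ?_⟩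
    obtain ⟨r, hr, h⟩ := hlittle.2 ε hε
    exact ⟨r, hr, fun z hz hrz => hV z hz ▸ h z hz hrz⟩
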